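/- Energy-identity decomposition of the least-squares functional (Appendix B): let w be smooth on the closure of Ω×(0,T) with w = 0 on ∂Ω × [0,T] and w(·,0) = 0 on Ω, and let f be smooth on the closure of Ω×(0,T). Then ½ ∫₀ᵀ ∫_Ω (∂_t w − Δw − f)² dx dt = ½ ∫₀ᵀ ∫_Ω ( (∂_t w)² + (Δw + f)² ) dx dt + ½ ∫_Ω |∇w(x,T)|² dx − ∫_Ω f(x,T) w(x,T) dx + ∫₀ᵀ ∫_Ω (∂_t f) w dx dt. -/

import Mathlib

open MeasureTheory

/-- Partial derivative in the `k`-th spatial direction. -/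
noncomputable def pdx {d : ℕ} (k : Fin d) (u : (Fin d → ℝ) → ℝ) (x : Fin d → ℝ) : ℝ :=
  fderiv ℝ u x (Pi.single k 1)

/-- Spatial Laplacian. -/
noncomputable def lapx {d : ℕ} (u : (Fin d → ℝ) → ℝ) (x : Fin d → ℝ) : ℝ :=
  ∑ k : Fin d, pdx k (pdx k u) x

/-- Time derivative. -/
noncomputable def pdt {d : ℕ} (v : (Fin d → ℝ) → ℝ → ℝ) (x : Fin d → ℝ) (t : ℝ) : ℝ :=
  deriv (v x) t

/-- Squared norm of the spatial gradient. -/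
noncomputable def gradSq {d : ℕ} (u : (Fin d → ℝ) → ℝ) (x : Fin d → ℝ) : ℝ :=
  ∑ k : Fin d, (pdx k u x) ^ 2

theorem exists_mem_segment_frontier {E : Type*} [NormedAddCommGroup E] [NormedSpace ℝ E]
    {s : Set E} {x y : E} (hx : x ∈ s) (hy : y ∉ s) : ∃ z ∈ segment ℝ x y, z ∈ frontier s := by
  have hc : IsPreconnected (segment ℝ x y) := (convex_segment x y).isPreconnected
  by_contra! h
  have hsub : segment ℝ x y ⊆ interior s ∪ (closure s)ᶜ := fun z hz ↦ by
    by_cases hzc : z ∈ closure s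
    · exact Or.inl (by_contra fun hi ↦ h z hz ⟨hzc, hi⟩)
    · exact Or.inr hzc
  obtain ⟨z, -, hz, hz'⟩ := hc _ _ isOpen_interior isClosed_closure.isOpen_compl hsub
    ⟨x, left_mem_segment ℝ x y, (hsub (left_mem_segment ℝ x y)).resolve_right
      fun h ↦ h (subset_closure hx)⟩
    ⟨y, right_mem_segment ℝ x y, (hsub (right_mem_segment ℝ x y)).resolve_left
      fun h ↦ hy (interior_subset h)⟩
  exact hz' (interior_subset_closure hz)

theorem exists_lipschitzWith_indicator {E : Type*} [NormedAddCommGroup E] [NormedSpace ℝ E]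
    [FiniteDimensional ℝ E] {s : Set E} (hs : Bornology.IsBounded s) {g : E → ℝ}
    (hg : ContDiff ℝ 1 g) (h0 : ∀ x ∈ frontier s, g x = 0) :
    ∃ C, LipschitzWith C (s.indicator g) := by
  obtain ⟨R, hR⟩ := hs.closure.subset_closedBall 0
  obtain ⟨C, hC⟩ := hg.contDiffOn.exists_lipschitzOnWith one_ne_zero
    (convex_closedBall (0 : E) R) (isCompact_closedBall 0 R)
  have hsR : s ⊆ Metric.closedBall 0 R := subset_closure.trans hR
  have key : ∀ x ∈ s, ∀ y ∉ s, ‖g x‖ ≤ C * ‖x - y‖ := fun x hx y hy ↦ by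
    obtain ⟨z, hz, hzf⟩ := exists_mem_segment_frontier hx hy
    have h1 := hC.norm_sub_le (hsR hx) (hR (frontier_subset_closure hzf))
    rw [h0 z hzf, sub_zero] at h1
    have h2 := dist_add_dist_of_mem_segment hz
    have h3 : ‖x - z‖ ≤ ‖x - y‖ := by
      rw [← dist_eq_norm, ← dist_eq_norm]; linarith [dist_nonneg (x := z) (y := y)]
    exact h1.trans (by gcongr)
  refine ⟨C, LipschitzWith.of_dist_le_mul fun x y ↦ ?_⟩
  rw [dist_eq_norm, dist_eq_norm]
  by_cases hx : x ∈ s <;> by_cases hy : y ∈ s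
  · simpa [hx, hy] using hC.norm_sub_le (hsR hx) (hsR hy)
  · simpa [hx, hy] using key x hx y hy
  · simpa [hx, hy, norm_sub_rev] using key y hy x hx
  · simpa [hx, hy] using by positivity

theorem ae_fderiv_eq_zero_of_eqOn_zero {E : Type*} [NormedAddCommGroup E] [NormedSpace ℝ E]
    [FiniteDimensional ℝ E] [MeasurableSpace E] [BorelSpace E] (μ : Measure E)
    [μ.IsAddHaarMeasure] {s : Set E} (hs : MeasurableSet s) {g : E → ℝ}
    (h0 : ∀ x ∈ s, g x = 0) (hg : ∀ᵐ x ∂μ, DifferentiableAt ℝ g x) (e : E) :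
    ∀ᵐ x ∂μ, x ∈ s → fderiv ℝ g x e = 0 := by
  by_cases he : e = 0
  · simp [he]
  have hm : MeasurableSet (s ∩ {x | DifferentiableAt ℝ g x}) :=
    hs.inter (measurableSet_of_differentiableAt ℝ g)
  have happ : ApproximatesLinearOn (fun x ↦ g x • e) (0 : E →L[ℝ] E)
      (s ∩ {x | DifferentiableAt ℝ g x}) 0 := fun x hx y hy ↦ by
    simp [h0 x hx.1, h0 y hy.1]
  have := happ.norm_fderiv_sub_le μ hm (fun x ↦ (fderiv ℝ g x).smulRight e)
    fun x hx ↦ (hx.2.hasFDerivAt.smul_const e).hasFDerivWithinAt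
  rw [ae_restrict_iff' hm] at this
  filter_upwards [this, hg] with x hx hd hxs
  have h := hx ⟨hxs, hd⟩
  have h' : fderiv ℝ g x = 0 := by simpa [he] using h
  simp [h']

/-- The integral over a bounded open set of a directional derivative of a `C¹` function vanishing
on the boundary is zero; no regularity of the boundary is needed. -/
theorem setIntegral_fderiv_eq_zero {E : Type*} [NormedAddCommGroup E] [NormedSpace ℝ E]
    [FiniteDimensional ℝ E] [MeasurableSpace E] [BorelSpace E] (μ : Measure E)
    [μ.IsAddHaarMeasure] {s : Set E} (hso : IsOpen s) (hs : Bornology.IsBounded s) {g : E → ℝ}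
    (hg : ContDiff ℝ 1 g) (h0 : ∀ x ∈ frontier s, g x = 0) (e : E) :
    ∫ x in s, fderiv ℝ g x e ∂μ = 0 := by
  obtain ⟨C, hC⟩ := exists_lipschitzWith_indicator hs hg h0
  have hcs : HasCompactSupport (s.indicator g) :=
    HasCompactSupport.of_support_subset_isCompact hs.isCompact_closure
      (Set.support_indicator_subset.trans subset_closure)
  have hint := (LipschitzWith.const (α := E) (1 : ℝ)).integral_lineDeriv_mul_eq (μ := μ) hC hcs (-e)
  have hz : ∫ x, lineDeriv ℝ (s.indicator g) x e ∂μ = 0 := by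
    simpa [lineDeriv] using hint.symm
  rw [← integral_indicator hso.measurableSet, ← hz]
  apply integral_congr_ae
  filter_upwards [hC.ae_differentiableAt (μ := μ), ae_fderiv_eq_zero_of_eqOn_zero μ
    hso.measurableSet.compl (fun x hx ↦ Set.indicator_of_notMem hx g)
    (hC.ae_differentiableAt (μ := μ)) e] with x hd hx
  rw [hd.lineDeriv_eq_fderiv]
  by_cases hxs : x ∈ s
  · have : s.indicator g =ᶠ[nhds x] g := by
      filter_upwards [hso.mem_nhds hxs] with y hy using Set.indicator_of_mem hy g
    rw [this.fderiv_eq, Set.indicator_of_mem hxs]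
  · rw [hx hxs, Set.indicator_of_notMem hxs]

theorem ContDiff.fderiv_apply_const {E : Type*} [NormedAddCommGroup E] [NormedSpace ℝ E]
    {u : E → ℝ} (hu : ContDiff ℝ (⊤ : ℕ∞) u) (v : E) :
    ContDiff ℝ (⊤ : ℕ∞) fun p ↦ fderiv ℝ u p v :=
  (hu.fderiv_right (m := (⊤ : ℕ∞)) le_rfl).clm_apply contDiff_const

theorem fderiv_prodMk_left_apply {E : Type*} [NormedAddCommGroup E] [NormedSpace ℝ E]
    {u : E × ℝ → ℝ} (hu : Differentiable ℝ u) (x : E) (t : ℝ) (v : E) :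
    fderiv ℝ (fun y ↦ u (y, t)) x v = fderiv ℝ u (x, t) (v, 0) := by
  have h : HasFDerivAt (fun y ↦ u (y, t)) _ x :=
    (hu (x, t)).hasFDerivAt.comp x (hasFDerivAt_prodMk_left x t)
  rw [h.fderiv]
  simp

theorem hasDerivAt_prodMk_right {E : Type*} [NormedAddCommGroup E] [NormedSpace ℝ E]
    {u : E × ℝ → ℝ} (hu : Differentiable ℝ u) (x : E) (t : ℝ) :
    HasDerivAt (fun s ↦ u (x, s)) (fderiv ℝ u (x, t) (0, 1)) t := by
  have h : HasFDerivAt (fun s ↦ u (x, s)) _ t :=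
    (hu (x, t)).hasFDerivAt.comp t (hasFDerivAt_prodMk_right x t)
  simpa using h.hasDerivAt

theorem fderiv_fderiv_apply_comm {E : Type*} [NormedAddCommGroup E] [NormedSpace ℝ E]
    {u : E → ℝ} (hu : ContDiff ℝ (⊤ : ℕ∞) u) (p v v' : E) :
    fderiv ℝ (fun q ↦ fderiv ℝ u q v) p v' = fderiv ℝ (fun q ↦ fderiv ℝ u q v') p v := by
  have hd : DifferentiableAt ℝ (fderiv ℝ u) p :=
    (hu.fderiv_right (m := (⊤ : ℕ∞)) le_rfl).differentiable (by simp) p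
  have hs : IsSymmSndFDerivAt ℝ u p :=
    hu.contDiffAt.isSymmSndFDerivAt
      (by simpa using (WithTop.coe_le_coe.2 le_top : ((2 : ℕ∞) : WithTop ℕ∞) ≤ (⊤ : ℕ∞)))
  rw [fderiv_clm_apply hd (differentiableAt_const _), fderiv_clm_apply hd (differentiableAt_const _)]
  simpa using hs v' v

theorem Continuous.integrable_swap_prod_restrict {E : Type*} [NormedAddCommGroup E]
    [NormedSpace ℝ E] [FiniteDimensional ℝ E] [MeasureSpace E] [BorelSpace E]
    [IsFiniteMeasureOnCompacts (volume : Measure E)] [SFinite (volume : Measure E)]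
    {F : E × ℝ → ℝ} (hF : Continuous F) {Ω : Set E} (hΩ : Bornology.IsBounded Ω) (a b : ℝ) :
    Integrable (fun p : ℝ × E ↦ F (p.2, p.1))
      ((volume.restrict (Set.Ioo a b)).prod (volume.restrict Ω)) := by
  have hc : Continuous fun p : ℝ × E ↦ F (p.2, p.1) := by fun_prop
  rw [Measure.prod_restrict]
  exact (hc.continuousOn.integrableOn_compact (isCompact_Icc.prod hΩ.isCompact_closure)).mono_set
    (Set.prod_mono Set.Ioo_subset_Icc_self subset_closure)

theorem Continuous.integrableOn_of_isBounded {E : Type*} [NormedAddCommGroup E]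
    [NormedSpace ℝ E] [FiniteDimensional ℝ E] [MeasurableSpace E] [BorelSpace E] {μ : Measure E}
    [IsFiniteMeasureOnCompacts μ] {F : E → ℝ} (hF : Continuous F) {Ω : Set E}
    (hΩ : Bornology.IsBounded Ω) : IntegrableOn F Ω μ :=
  (hF.continuousOn.integrableOn_compact hΩ.isCompact_closure).mono_set subset_closure

/-- Energy-identity decomposition of the least-squares functional (Appendix B):
for smooth `w` vanishing on `∂Ω × [0,T]` and at `t = 0`, and smooth `f`,
`½∫₀ᵀ∫_Ω (∂ₜw − Δw − f)² = ½∫₀ᵀ∫_Ω ((∂ₜw)² + (Δw + f)²) + ½∫_Ω |∇w(x,T)|²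
  − ∫_Ω f(x,T) w(x,T) + ∫₀ᵀ∫_Ω (∂ₜf) w`. -/
theorem energy_identity_least_squares
    {d : ℕ} (Ω : Set (Fin d → ℝ)) (hΩo : IsOpen Ω) (hΩb : Bornology.IsBounded Ω)
    (T : ℝ) (hT : 0 < T) (w f : (Fin d → ℝ) → ℝ → ℝ)
    (hw : ContDiff ℝ (⊤ : ℕ∞) (Function.uncurry w))
    (hf : ContDiff ℝ (⊤ : ℕ∞) (Function.uncurry f))
    (hbc : ∀ x ∈ frontier Ω, ∀ t ∈ Set.Icc (0:ℝ) T, w x t = 0)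
    (hic : ∀ x ∈ Ω, w x 0 = 0) :
    (1/2 : ℝ) * ∫ t in Set.Ioo (0:ℝ) T, ∫ x in Ω,
        (pdt w x t - lapx (fun y => w y t) x - f x t) ^ 2
      = (1/2 : ℝ) * (∫ t in Set.Ioo (0:ℝ) T, ∫ x in Ω,
            ((pdt w x t) ^ 2 + (lapx (fun y => w y t) x + f x t) ^ 2))
        + (1/2 : ℝ) * (∫ x in Ω, gradSq (fun y => w y T) x)
        - (∫ x in Ω, f x T * w x T)
        + ∫ t in Set.Ioo (0:ℝ) T, ∫ x in Ω, pdt f x t * w x t := by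
  set W := Function.uncurry w
  set F := Function.uncurry f
  set A : (Fin d → ℝ) × ℝ → ℝ := fun p ↦ fderiv ℝ W p (0, 1) with hA
  set G : Fin d → (Fin d → ℝ) × ℝ → ℝ := fun k p ↦ fderiv ℝ W p (Pi.single k 1, 0) with hG
  set H : Fin d → (Fin d → ℝ) × ℝ → ℝ := fun k p ↦ fderiv ℝ (G k) p (Pi.single k 1, 0) with hH
  set L : (Fin d → ℝ) × ℝ → ℝ := fun p ↦ ∑ k, H k p with hL
  set B : (Fin d → ℝ) × ℝ → ℝ := fun p ↦ fderiv ℝ F p (0, 1) with hB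
  set e : (Fin d → ℝ) × ℝ → ℝ := fun p ↦ (1/2 : ℝ) * ∑ k, G k p ^ 2 - F p * W p with he
  set e' : (Fin d → ℝ) × ℝ → ℝ := fun p ↦ fderiv ℝ e p (0, 1) with he'
  have sA : ContDiff ℝ (⊤ : ℕ∞) A := hw.fderiv_apply_const _
  have sG : ∀ k, ContDiff ℝ (⊤ : ℕ∞) (G k) := fun k ↦ hw.fderiv_apply_const _
  have sH : ∀ k, ContDiff ℝ (⊤ : ℕ∞) (H k) := fun k ↦ (sG k).fderiv_apply_const _
  have sB : ContDiff ℝ (⊤ : ℕ∞) B := hf.fderiv_apply_const _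
  have se : ContDiff ℝ (⊤ : ℕ∞) e := by fun_prop
  have se' : ContDiff ℝ (⊤ : ℕ∞) e' := se.fderiv_apply_const _
  have cA := sA.continuous
  have cL : Continuous L := continuous_finsetSum _ fun k _ ↦ (sH k).continuous
  have cB := sB.continuous
  have cF := hf.continuous
  have cW := hw.continuous
  have dW : Differentiable ℝ W := hw.differentiable (by simp)
  have dF : Differentiable ℝ F := hf.differentiable (by simp)
  have dA : Differentiable ℝ A := sA.differentiable (by simp)
  have dG : ∀ k, Differentiable ℝ (G k) := fun k ↦ (sG k).differentiable (by simp)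
  have de : Differentiable ℝ e := se.differentiable (by simp)
  have pdt_w : ∀ x t, pdt w x t = A (x, t) := fun x t ↦ (hasDerivAt_prodMk_right dW x t).deriv
  have pdt_f : ∀ x t, pdt f x t = B (x, t) := fun x t ↦ (hasDerivAt_prodMk_right dF x t).deriv
  have pdx_w : ∀ k x t, pdx k (fun y ↦ w y t) x = G k (x, t) := fun k x t ↦
    fderiv_prodMk_left_apply dW x t _
  have lap_w : ∀ x t, lapx (fun y ↦ w y t) x = L (x, t) := fun x t ↦ by
    refine Finset.sum_congr rfl fun k _ ↦ ?_
    rw [funext fun y ↦ pdx_w k y t]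
    exact fderiv_prodMk_left_apply (dG k) x t _
  have grad_w : ∀ x t, gradSq (fun y ↦ w y t) x = ∑ k, G k (x, t) ^ 2 := fun x t ↦
    Finset.sum_congr rfl fun k _ ↦ by rw [pdx_w]
  have w_eq : ∀ x t, w x t = W (x, t) := fun _ _ ↦ rfl
  have f_eq : ∀ x t, f x t = F (x, t) := fun _ _ ↦ rfl
  have pointwise : ∀ p, A p * (L p + F p) + B p * W p + e' p =
      ∑ k, fderiv ℝ (fun q ↦ A q * G k q) p (Pi.single k 1, 0) := fun p ↦ by
    have h1 : e' p = ∑ k, G k p * fderiv ℝ (G k) p (0, 1) - (F p * A p + W p * B p) := by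
      have hs : HasFDerivAt e _ p := ((HasFDerivAt.fun_sum fun k (_ : k ∈ Finset.univ) ↦
        (dG k p).hasFDerivAt.pow 2).const_mul (1/2 : ℝ)).sub
          ((dF p).hasFDerivAt.mul (dW p).hasFDerivAt)
      simp only [he', hs.fderiv]
      simp [Finset.mul_sum, hA, hB, mul_assoc]
    have h2 : ∀ k, fderiv ℝ (fun q ↦ A q * G k q) p (Pi.single k 1, 0) =
        A p * H k p + G k p * fderiv ℝ (G k) p (0, 1) := fun k ↦ by
      rw [fderiv_fun_mul (dA p) (dG k p)]
      simp [hA, hG, hH, fderiv_fderiv_apply_comm hw p (0, 1)]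
    simp only [h1, h2, Finset.sum_add_distrib, hL, ← Finset.mul_sum]
    ring
  have A_frontier : ∀ x ∈ frontier Ω, ∀ t ∈ Set.Ioo (0 : ℝ) T, A (x, t) = 0 := fun x hx t ht ↦ by
    have h : w x =ᶠ[nhds t] fun _ ↦ 0 := by
      filter_upwards [Ioo_mem_nhds ht.1 ht.2] with s hs using hbc x hx s ⟨hs.1.le, hs.2.le⟩
    rw [← pdt_w, pdt, h.deriv_eq, deriv_const]
  have space : ∀ t ∈ Set.Ioo (0 : ℝ) T,
      ∫ x in Ω, (A (x, t) * (L (x, t) + F (x, t)) + B (x, t) * W (x, t) + e' (x, t)) = 0 :=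
    fun t ht ↦ by
    have sAG : ∀ k, ContDiff ℝ (⊤ : ℕ∞) fun q ↦ A q * G k q := fun k ↦ sA.mul (sG k)
    simp only [pointwise]
    rw [integral_finsetSum]
    · refine Finset.sum_eq_zero fun k _ ↦ ?_
      simp only [← fderiv_prodMk_left_apply ((sAG k).differentiable (by simp))]
      refine setIntegral_fderiv_eq_zero volume hΩo hΩb ?_
        (fun x hx ↦ by simp [A_frontier x hx t ht]) _
      exact ((sAG k).comp (contDiff_prodMk_left t)).of_le (by simp)
    · intro k _
      have := ((sAG k).fderiv_apply_const (Pi.single k 1, 0)).continuous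
      exact Continuous.integrableOn_of_isBounded (by fun_prop) hΩb
  have time : ∫ t in Set.Ioo (0 : ℝ) T, ∫ x in Ω, e' (x, t) = ∫ x in Ω, e (x, T) := by
    rw [integral_integral_swap (se'.continuous.integrable_swap_prod_restrict hΩb 0 T)]
    refine setIntegral_congr_fun hΩo.measurableSet fun x hx ↦ ?_
    have h0 : e (x, 0) = 0 := by
      have hG0 : ∀ k, G k (x, 0) = 0 := fun k ↦ by
        have h : (fun y ↦ w y 0) =ᶠ[nhds x] fun _ ↦ 0 := by
          filter_upwards [hΩo.mem_nhds hx] with y hy using hic y hy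
        rw [← pdx_w, pdx, h.fderiv_eq]
        simp
      simp [he, hG0, ← w_eq, hic x hx]
    have hc : Continuous fun t ↦ e' (x, t) := by have := se'.continuous; fun_prop
    have h := intervalIntegral.integral_eq_sub_of_hasDerivAt
      (fun t _ ↦ hasDerivAt_prodMk_right de x t) (hc.intervalIntegrable 0 T)
    rw [h0, sub_zero, intervalIntegral.integral_of_le hT.le, integral_Ioc_eq_integral_Ioo] at h
    exact h
  have final : ∫ x in Ω, e (x, T) =
      (1/2 : ℝ) * (∫ x in Ω, ∑ k, G k (x, T) ^ 2) - ∫ x in Ω, F (x, T) * W (x, T) := by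
    have cG := fun k ↦ (sG k).continuous
    rw [← integral_const_mul, ← integral_sub]
    · exact Continuous.integrableOn_of_isBounded (by fun_prop) hΩb
    · exact Continuous.integrableOn_of_isBounded (by fun_prop) hΩb
  simp only [pdt_w, pdt_f, lap_w, grad_w]
  simp only [w_eq, f_eq]
  have toProd : ∀ φ : (Fin d → ℝ) × ℝ → ℝ, Continuous φ →
      ∫ t in Set.Ioo (0 : ℝ) T, ∫ x in Ω, φ (x, t) =
        ∫ p, φ (p.2, p.1) ∂((volume.restrict (Set.Ioo (0 : ℝ) T)).prod (volume.restrict Ω)) :=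
    fun φ hφ ↦ (integral_prod _ (hφ.integrable_swap_prod_restrict hΩb 0 T)).symm
  have int := fun (φ : (Fin d → ℝ) × ℝ → ℝ) (hφ : Continuous φ) ↦
    hφ.integrable_swap_prod_restrict hΩb 0 T
  have ce' := se'.continuous
  have zero : ∫ t in Set.Ioo (0 : ℝ) T, ∫ x in Ω,
      (A (x, t) * (L (x, t) + F (x, t)) + B (x, t) * W (x, t) + e' (x, t)) = 0 :=
    setIntegral_eq_zero_of_forall_eq_zero space
  rw [toProd (fun p ↦ A p * (L p + F p) + B p * W p + e' p) (by fun_prop),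
    integral_add (int (fun p ↦ A p * (L p + F p) + B p * W p) (by fun_prop)) (int e' ce'),
    integral_add (int (fun p ↦ A p * (L p + F p)) (by fun_prop))
      (int (fun p ↦ B p * W p) (by fun_prop))] at zero
  rw [toProd e' ce', final] at time
  rw [toProd (fun p ↦ (A p - L p - F p) ^ 2) (by fun_prop),
    toProd (fun p ↦ A p ^ 2 + (L p + F p) ^ 2) (by fun_prop),
    toProd (fun p ↦ B p * W p) (by fun_prop)]
  have expand : ∀ p, (A p - L p - F p) ^ 2 =
      (A p ^ 2 + (L p + F p) ^ 2) - 2 * (A p * (L p + F p)) := fun p ↦ by ring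
  simp only [expand]
  rw [integral_sub (int (fun p ↦ A p ^ 2 + (L p + F p) ^ 2) (by fun_prop))
    (int (fun p ↦ 2 * (A p * (L p + F p))) (by fun_prop)), integral_const_mul]
  linarith
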